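/- Every harmonic polynomial h of even degree 2n on ℝ³ can be written as a difference of harmonic squares: h = h₁ ∗ h₁ − h₂ ∗ h₂ with h₁, h₂ harmonic of degree n. -/

import Mathlib

open MvPolynomial

/-- The quadratic form `q(x,y,z) = x² + y² + z²`. -/
noncomputable def qForm : MvPolynomial (Fin 3) ℝ := ∑ i : Fin 3, X i ^ 2

/-- The Laplacian of a polynomial on `ℝ³`. -/
noncomputable def lap (p : MvPolynomial (Fin 3) ℝ) : MvPolynomial (Fin 3) ℝ :=
  ∑ i : Fin 3, pderiv i (pderiv i p)

/-- A polynomial is harmonic if its Laplacian vanishes. -/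
def Harmonic (p : MvPolynomial (Fin 3) ℝ) : Prop := lap p = 0

/-- `star` is a harmonic product: on harmonic polynomials, `star h₁ h₂` is the harmonic
projection `(h₁h₂)₀` of the ordinary product. -/
def IsHarmonicProduct (star : MvPolynomial (Fin 3) ℝ → MvPolynomial (Fin 3) ℝ →
    MvPolynomial (Fin 3) ℝ) : Prop :=
  ∀ h₁ h₂, Harmonic h₁ → Harmonic h₂ →
    Harmonic (star h₁ h₂) ∧ ∃ g, h₁ * h₂ - star h₁ h₂ = qForm * g


/-- The Fischer pairing `⟨p, r⟩ = ∑ α! p_α r_α = (p(∂) r)(0)`. -/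
noncomputable def fischer (p r : MvPolynomial (Fin 3) ℝ) : ℝ :=
  Finsupp.sum (AddMonoidAlgebra.coeff p) fun α c => c * ((∏ i, (α i).factorial : ℕ) * r.coeff α)

lemma fischer_add_left (p p' r : MvPolynomial (Fin 3) ℝ) :
    fischer (p + p') r = fischer p r + fischer p' r :=
  Finsupp.sum_add_index' (by simp) (by intros; ring)

lemma fischer_add_right (p r r' : MvPolynomial (Fin 3) ℝ) :
    fischer p (r + r') = fischer p r + fischer p r' := by
  simp [fischer, mul_add]

lemma fischer_monomial_left (α : Fin 3 →₀ ℕ) (c : ℝ) (r : MvPolynomial (Fin 3) ℝ) :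
    fischer (monomial α c) r = c * ((∏ i, (α i).factorial : ℕ) * r.coeff α) :=
  sum_monomial_eq (by simp)

lemma fischer_zero_right (p : MvPolynomial (Fin 3) ℝ) : fischer p 0 = 0 := by
  simp [fischer]

lemma eq_zero_of_fischer_self {p : MvPolynomial (Fin 3) ℝ} (hp : fischer p p = 0) : p = 0 := by
  rw [fischer, sum_def, Finset.sum_eq_zero_iff_of_nonneg] at hp
  · rw [← support_eq_empty, Finset.eq_empty_iff_forall_notMem]
    intro α hα
    have h := hp α hα
    have hc := mem_support_iff.mp hα
    have hN : ((∏ i, (α i).factorial : ℕ) : ℝ) ≠ 0 :=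
      Nat.cast_ne_zero.mpr (Finset.prod_ne_zero_iff.mpr fun i _ => Nat.factorial_ne_zero _)
    simp_all
  · intro α _
    rw [mul_left_comm]
    exact mul_nonneg (Nat.cast_nonneg _) (mul_self_nonneg _)

/-- Multiplication by `X i` is adjoint to `∂ᵢ` for the Fischer pairing. -/
lemma fischer_X_mul (i : Fin 3) (p r : MvPolynomial (Fin 3) ℝ) :
    fischer (X i * p) r = fischer p (pderiv i r) := by
  induction p using MvPolynomial.induction_on' with
  | add p q hp hq => rw [mul_add, fischer_add_left, fischer_add_left, hp, hq]
  | monomial α c =>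
    have hfac : (∏ j, ((α + Finsupp.single i 1 : Fin 3 →₀ ℕ) j).factorial : ℕ) =
        (α i + 1) * ∏ j, (α j).factorial := by
      fin_cases i <;> simp [Fin.prod_univ_three, Nat.factorial_succ] <;> ring
    rw [X, monomial_mul, one_mul, add_comm, fischer_monomial_left, fischer_monomial_left,
      coeff_pderiv, hfac]
    push_cast
    ring

lemma fischer_qForm_mul (p r : MvPolynomial (Fin 3) ℝ) :
    fischer (qForm * p) r = fischer p (lap r) := by
  simp only [qForm, lap, Fin.sum_univ_three, add_mul, fischer_add_left, fischer_add_right, pow_two,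
    mul_assoc, fischer_X_mul]

lemma lap_add (p r : MvPolynomial (Fin 3) ℝ) : lap (p + r) = lap p + lap r := by
  simp [lap, Finset.sum_add_distrib]

lemma lap_smul (c : ℝ) (p : MvPolynomial (Fin 3) ℝ) : lap (c • p) = c • lap p := by
  simp [lap, Finset.smul_sum]

lemma lap_sub (p r : MvPolynomial (Fin 3) ℝ) : lap (p - r) = lap p - lap r := by
  simp [lap, Finset.sum_sub_distrib]

/-- A harmonic multiple of `qForm` vanishes. -/
lemma Harmonic.eq_zero_of_dvd {p : MvPolynomial (Fin 3) ℝ} (hp : Harmonic p) (hq : qForm ∣ p) :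
    p = 0 := by
  obtain ⟨g, rfl⟩ := hq
  apply eq_zero_of_fischer_self
  rw [fischer_qForm_mul, show lap (qForm * g) = 0 from hp, fischer_zero_right]

lemma qForm_isHomogeneous : qForm.IsHomogeneous 2 :=
  IsHomogeneous.sum _ _ _ fun i _ => isHomogeneous_X_pow i 2

lemma qForm_ne_zero : qForm ≠ 0 := by
  intro h
  simpa [qForm] using congrArg (eval fun _ => (1 : ℝ)) h

lemma lap_isHomogeneous {p : MvPolynomial (Fin 3) ℝ} {m : ℕ} (hp : p.IsHomogeneous m) :
    (lap p).IsHomogeneous (m - 2) :=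
  IsHomogeneous.sum _ _ _ fun _ _ => hp.pderiv.pderiv

/-- Every homogeneous polynomial is congruent to a harmonic one modulo `qForm`. -/
lemma exists_harmonic_sub {m : ℕ} {p : MvPolynomial (Fin 3) ℝ} (hp : p.IsHomogeneous m) :
    ∃ r, Harmonic r ∧ r.IsHomogeneous m ∧ qForm ∣ p - r := by
  rcases lt_or_ge m 2 with hm | hm
  · refine ⟨p, ?_, hp, by simp⟩
    refine Finset.sum_eq_zero fun i _ => ?_
    have h : (pderiv i p).IsHomogeneous 0 := by
      simpa [show m - 1 = 0 by omega] using hp.pderiv (i := i)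
    rw [← totalDegree_zero_iff_isHomogeneous, totalDegree_eq_zero_iff_eq_C] at h
    rw [h, pderiv_C]
  · obtain ⟨k, rfl⟩ := Nat.exists_eq_add_of_le hm
    let V := homogeneousSubmodule (Fin 3) ℝ k
    have : FiniteDimensional ℝ V := Module.Finite.iff_fg.mpr (homogeneousSubmodule_fg _ _ k)
    have hmul : ∀ g : V, (qForm * g.1).IsHomogeneous (2 + k) := fun g =>
      qForm_isHomogeneous.mul g.2
    let T : V →ₗ[ℝ] V :=
      { toFun g := ⟨lap (qForm * g.1), by simpa [V] using lap_isHomogeneous (hmul g)⟩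
        map_add' g g' := Subtype.ext (by simp [mul_add, lap_add])
        map_smul' c g := Subtype.ext (by simp [lap_smul]) }
    have hT : Function.Injective T := by
      rw [← LinearMap.ker_eq_bot, LinearMap.ker_eq_bot']
      intro g hg
      have h := Harmonic.eq_zero_of_dvd (congrArg Subtype.val hg) (dvd_mul_right qForm g.1)
      exact Subtype.ext ((mul_eq_zero.mp h).resolve_left qForm_ne_zero)
    obtain ⟨g, hg⟩ := LinearMap.surjective_of_injective hT
      ⟨lap p, by simpa [V] using lap_isHomogeneous hp⟩
    refine ⟨p - qForm * g.1, ?_, hp.sub (hmul g), by simp⟩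
    rw [Harmonic, lap_sub, sub_eq_zero]
    exact (congrArg Subtype.val hg).symm

/-- The linear form with coefficient vector `a`. -/
noncomputable def linForm (a : Fin 3 → ℝ) : MvPolynomial (Fin 3) ℝ := ∑ i, C (a i) * X i

lemma linForm_isHomogeneous (a : Fin 3 → ℝ) : (linForm a).IsHomogeneous 1 :=
  IsHomogeneous.sum _ _ _ fun i _ => isHomogeneous_C_mul_X (a i) i

/-- The columns of a matrix with rows `a`, `b`, `c` are orthonormal. -/
def OrthonormalColumns (a b c : Fin 3 → ℝ) : Prop :=
  ∀ i j, a i * a j + b i * b j + c i * c j = if i = j then 1 else 0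

lemma OrthonormalColumns.X_eq {a b c : Fin 3 → ℝ} (h : OrthonormalColumns a b c) (i : Fin 3) :
    X i = C (a i) * linForm a + C (b i) * linForm b + C (c i) * linForm c := by
  have h' (j : Fin 3) : C (a i) * C (a j) + C (b i) * C (b j) + C (c i) * C (c j) =
      if i = j then (1 : MvPolynomial (Fin 3) ℝ) else 0 := by
    simp only [← C_mul, ← C_add, h i j]
    split_ifs <;> simp
  have hX : (X i : MvPolynomial (Fin 3) ℝ) = ∑ j, (if i = j then 1 else 0) * X j := by simp
  rw [hX]
  simp only [← h', linForm, Fin.sum_univ_three]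
  ring

lemma OrthonormalColumns.qForm_eq {a b c : Fin 3 → ℝ} (h : OrthonormalColumns a b c) :
    qForm = linForm a ^ 2 + linForm b ^ 2 + linForm c ^ 2 := by
  calc qForm = ∑ i, X i * (C (a i) * linForm a + C (b i) * linForm b + C (c i) * linForm c) :=
        Finset.sum_congr rfl fun i _ => by rw [← h.X_eq i, pow_two]
    _ = (∑ i, C (a i) * X i) * linForm a + (∑ i, C (b i) * X i) * linForm b +
          (∑ i, C (c i) * X i) * linForm c := by
        simp only [Fin.sum_univ_three]; ring
    _ = _ := by simp only [linForm, pow_two]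

/-- In the orthonormal coordinates `u`, `w`, `l` a form of degree `d + 1` reduces modulo `u² + w²`
and `l` to a combination of `u ^ (d + 1)` and `u ^ d * w`. -/
lemma OrthonormalColumns.exists_reduction {a b c : Fin 3 → ℝ} (h : OrthonormalColumns a b c)
    (d : ℕ) {f : MvPolynomial (Fin 3) ℝ} (hf : f.IsHomogeneous (d + 1)) :
    ∃ (α β : ℝ) (k : MvPolynomial (Fin 3) ℝ), k.IsHomogeneous d ∧
      qForm ∣ f - (C α * linForm a ^ (d + 1) + C β * (linForm a ^ d * linForm b) +
        linForm c * k) := by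
  induction d generalizing f with
  | zero =>
    have hc (i : Fin 3) : ∃ r : ℝ, pderiv i f = C r := by
      have hi : (pderiv i f).IsHomogeneous 0 := hf.pderiv
      rw [← totalDegree_zero_iff_isHomogeneous, totalDegree_eq_zero_iff_eq_C] at hi
      exact ⟨_, hi⟩
    choose r hr using hc
    have hE := hf.sum_X_mul_pderiv
    simp only [hr, h.X_eq, zero_add, one_smul] at hE
    refine ⟨∑ i, a i * r i, ∑ i, b i * r i, C (∑ i, c i * r i), isHomogeneous_C _ _, ?_⟩
    rw [← hE]
    refine ⟨0, ?_⟩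
    simp only [Fin.sum_univ_three, C_add, C_mul]
    ring
  | succ d ih =>
    choose α β k hk g hg using fun i : Fin 3 => ih (f := pderiv i f) hf.pderiv
    let s : ℝ := (d + 2 : ℝ)⁻¹
    have hE : f = C s * ∑ i, X i * pderiv i f := by
      rw [hf.sum_X_mul_pderiv, nsmul_eq_mul, ← mul_assoc, ← C_eq_coe_nat, ← C_mul]
      have : s * ((d + 1 + 1 : ℕ) : ℝ) = 1 := by
        simp only [s]; push_cast; field_simp; ring
      rw [this, C_1, one_mul]
    refine ⟨s * ∑ i, (a i * α i - b i * β i), s * ∑ i, (a i * β i + b i * α i),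
      C s * ∑ i, (X i * k i + C (c i) * (C (α i) * linForm a ^ (d + 1) +
        C (β i) * (linForm a ^ d * linForm b)) - C (b i * β i) * (linForm a ^ d * linForm c)),
      ?_, C s * ∑ i, (X i * g i + C (b i * β i) * linForm a ^ d), ?_⟩
    · have hu (m : ℕ) : (linForm a ^ m).IsHomogeneous m := by
        simpa using (linForm_isHomogeneous a).pow m
      refine IsHomogeneous.C_mul (IsHomogeneous.sum _ _ _ fun i _ => ?_) _
      refine ((add_comm 1 d ▸ (isHomogeneous_X ℝ i).mul (hk i)).add ?_).sub ?_
      · exact ((hu _).C_mul _ |>.add (((hu d).mul (linForm_isHomogeneous b)).C_mul _)).C_mul _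
      · exact ((hu d).mul (linForm_isHomogeneous c)).C_mul _
    · have hg' (i : Fin 3) : X i * pderiv i f = X i * (qForm * g i + linForm c * k i) +
          (C (a i) * linForm a + C (b i) * linForm b + C (c i) * linForm c) *
          (C (α i) * linForm a ^ (d + 1) + C (β i) * (linForm a ^ d * linForm b)) := by
        rw [← h.X_eq]
        linear_combination X i * hg i
      rw [sub_eq_iff_eq_add]
      conv_lhs => rw [hE]
      simp only [hg', Fin.sum_univ_three, C_add, C_sub, C_mul]
      have hq := h.qForm_eq
      linear_combination
        -(C s * linForm a ^ d * (C (b 0) * C (β 0) + C (b 1) * C (β 1) + C (b 2) * C (β 2))) * hq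

lemma aeval_smul_of_isHomogeneous {m : ℕ} {f : MvPolynomial (Fin 3) ℝ}
    (hf : f.IsHomogeneous m) (r : ℂ) (v : Fin 3 → ℂ) :
    aeval (r • v) f = r ^ m * aeval v f := by
  simp only [aeval_def, eval₂_eq', Finset.mul_sum]
  refine Finset.sum_congr rfl fun e he => ?_
  have hdeg := hf.degree_eq_sum_deg_support he
  rw [← Finsupp.degree_apply, Finsupp.degree_eq_sum] at hdeg
  simp only [Pi.smul_apply, smul_eq_mul, mul_pow, Finset.prod_mul_distrib,
    Finset.prod_pow_eq_pow_sum, hdeg]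
  ring

/-- On a polynomial curve without a zero of `f`, the polynomial `f` is constant. -/
lemma exists_aeval_eq_zero_or_const (f : MvPolynomial (Fin 3) ℝ) (P : Fin 3 → Polynomial ℂ) :
    (∃ s, aeval (fun i => (P i).eval s) f = 0) ∨
      ∃ c ≠ 0, ∀ s, aeval (fun i => (P i).eval s) f = c := by
  have hev (s : ℂ) : (aeval P f).eval s = aeval (fun i => (P i).eval s) f := by
    have := congrArg (fun φ : MvPolynomial (Fin 3) ℝ →ₐ[ℝ] ℂ => φ f)
      (comp_aeval P ((Polynomial.aeval (R := ℂ) s).restrictScalars ℝ))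
    simpa [Polynomial.coe_aeval_eq_eval] using this
  simp only [← hev]
  rcases lt_or_ge 0 (aeval P f).degree with hd | hd
  · exact Or.inl (Complex.exists_root hd)
  · rw [Polynomial.eq_C_of_degree_le_zero hd]
    simp only [Polynomial.eval_C]
    by_cases hc : (aeval P f).coeff 0 = 0
    · exact Or.inl ⟨0, hc⟩
    · exact Or.inr ⟨_, hc, fun _ => rfl⟩

/-- A form of positive degree has a nontrivial zero on the complex cone `x² + y² + z² = 0`. -/
lemma exists_zero_on_cone {m : ℕ} (hm : m ≠ 0) {f : MvPolynomial (Fin 3) ℝ}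
    (hf : f.IsHomogeneous m) :
    ∃ v : Fin 3 → ℂ, v ≠ 0 ∧ v 0 ^ 2 + v 1 ^ 2 + v 2 ^ 2 = 0 ∧ aeval v f = 0 := by
  let φ (s t : ℂ) : Fin 3 → ℂ := ![(s ^ 2 - t ^ 2) / 2, -Complex.I * (s ^ 2 + t ^ 2) / 2, s * t]
  have hφ (s t : ℂ) : φ s t 0 ^ 2 + φ s t 1 ^ 2 + φ s t 2 ^ 2 = 0 := by
    simp only [φ, Matrix.cons_val]
    linear_combination (s ^ 2 + t ^ 2) ^ 2 / 4 * Complex.I_sq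
  have hφ_add (s t : ℂ) : φ s t 0 + Complex.I * φ s t 1 = s ^ 2 := by
    simp only [φ, Matrix.cons_val]
    linear_combination -(s ^ 2 + t ^ 2) / 2 * Complex.I_sq
  have hφ_sub (s t : ℂ) : φ s t 0 - Complex.I * φ s t 1 = -t ^ 2 := by
    simp only [φ, Matrix.cons_val]
    linear_combination (s ^ 2 + t ^ 2) / 2 * Complex.I_sq
  have hs_curve := exists_aeval_eq_zero_or_const f
    ![Polynomial.C (1 / 2) * (Polynomial.X ^ 2 - 1),
      Polynomial.C (-Complex.I / 2) * (Polynomial.X ^ 2 + 1), Polynomial.X]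
  have ht_curve := exists_aeval_eq_zero_or_const f
    ![Polynomial.C (1 / 2) * (1 - Polynomial.X ^ 2),
      Polynomial.C (-Complex.I / 2) * (1 + Polynomial.X ^ 2), Polynomial.X]
  have hs (s : ℂ) : (fun i => (![Polynomial.C (1 / 2) * (Polynomial.X ^ 2 - 1),
      Polynomial.C (-Complex.I / 2) * (Polynomial.X ^ 2 + 1),
      Polynomial.X] i : Polynomial ℂ).eval s) = φ s 1 := by
    ext i; fin_cases i <;> simp [φ] <;> ring
  have ht (t : ℂ) : (fun i => (![Polynomial.C (1 / 2) * (1 - Polynomial.X ^ 2),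
      Polynomial.C (-Complex.I / 2) * (1 + Polynomial.X ^ 2),
      Polynomial.X] i : Polynomial ℂ).eval t) = φ 1 t := by
    ext i; fin_cases i <;> simp [φ] <;> ring
  simp only [hs] at hs_curve
  simp only [ht] at ht_curve
  rcases hs_curve with ⟨s, hs0⟩ | ⟨c, hc, hsc⟩
  · refine ⟨φ s 1, fun h => ?_, hφ s 1, hs0⟩
    simpa [h] using hφ_sub s 1
  rcases ht_curve with ⟨t, ht0⟩ | ⟨e, -, hte⟩
  · refine ⟨φ 1 t, fun h => ?_, hφ 1 t, ht0⟩
    simpa [h] using hφ_add 1 t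
  have hscale : φ 1 2 = (4 : ℂ) • φ (1 / 2) 1 := by
    ext i; fin_cases i <;> simp [φ] <;> ring
  have h1 := hte 2
  rw [hscale, aeval_smul_of_isHomogeneous hf, hsc, ← hte 1, hsc] at h1
  have h4 : (4 : ℂ) ^ m = 1 := mul_right_cancel₀ hc (by rw [h1, one_mul])
  have hpow : (4 : ℕ) ^ m = 1 := by exact_mod_cast h4
  simp [hm] at hpow

/-- A form of positive degree vanishes at `a + i b` for some orthonormal `a`, `b`, which are
completed here to an orthonormal basis. -/
lemma exists_orthonormalColumns_aeval_eq_zero {m : ℕ} (hm : m ≠ 0)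
    {f : MvPolynomial (Fin 3) ℝ} (hf : f.IsHomogeneous m) :
    ∃ a b c : Fin 3 → ℝ, OrthonormalColumns a b c ∧ a ⬝ᵥ a = 1 ∧ a ⬝ᵥ b = 0 ∧ b ⬝ᵥ b = 1 ∧
      c ⬝ᵥ a = 0 ∧ c ⬝ᵥ b = 0 ∧ aeval (fun i => (a i + b i * Complex.I : ℂ)) f = 0 := by
  obtain ⟨v, hv, hq, hz⟩ := exists_zero_on_cone hm hf
  let N : ℝ := (v 0).re ^ 2 + (v 1).re ^ 2 + (v 2).re ^ 2
  have hre := congrArg Complex.re hq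
  have him := congrArg Complex.im hq
  simp only [pow_two, Complex.add_re, Complex.mul_re, Complex.zero_re, Complex.add_im,
    Complex.mul_im, Complex.zero_im] at hre him
  have hN : 0 < N := by
    refine lt_of_le_of_ne (by positivity) fun h0 => hv ?_
    simp only [N] at h0
    ext i
    apply Complex.ext <;> fin_cases i <;> simp only [Pi.zero_apply, Complex.zero_re, Complex.zero_im,
      Fin.zero_eta, Fin.mk_one, Fin.reduceFinMk] <;>
      nlinarith [sq_nonneg (v 0).re, sq_nonneg (v 1).re, sq_nonneg (v 2).re, sq_nonneg (v 0).im,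
        sq_nonneg (v 1).im, sq_nonneg (v 2).im]
  let r : ℝ := (√N)⁻¹
  have hr : r ^ 2 * N = 1 := by
    simp only [r, inv_pow, Real.sq_sqrt hN.le]
    exact inv_mul_cancel₀ hN.ne'
  let a : Fin 3 → ℝ := fun i => r * (v i).re
  let b : Fin 3 → ℝ := fun i => r * (v i).im
  have haa : a ⬝ᵥ a = 1 := by
    simp only [dotProduct, Fin.sum_univ_three, a, N] at hr ⊢
    linear_combination hr
  have hbb : b ⬝ᵥ b = 1 := by
    simp only [dotProduct, Fin.sum_univ_three, b, N] at hr ⊢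
    linear_combination hr - r ^ 2 * hre
  have hab : a ⬝ᵥ b = 0 := by
    simp only [dotProduct, Fin.sum_univ_three, a, b]
    linear_combination r ^ 2 / 2 * him
  have hca : crossProduct a b ⬝ᵥ a = 0 := by rw [dotProduct_comm, dot_self_cross]
  have hcb : crossProduct a b ⬝ᵥ b = 0 := by rw [dotProduct_comm, dot_cross_self]
  have hcc : crossProduct a b ⬝ᵥ crossProduct a b = 1 := by
    rw [cross_dot_cross, haa, hbb, hab, dotProduct_comm b a, hab]; norm_num
  refine ⟨a, b, crossProduct a b, ?_, haa, hab, hbb, hca, hcb, ?_⟩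
  · let M : Matrix (Fin 3) (Fin 3) ℝ := Matrix.of ![a, b, crossProduct a b]
    have hM : M * M.transpose = 1 := by
      ext i j
      change (![a, b, crossProduct a b] i) ⬝ᵥ (![a, b, crossProduct a b] j) = _
      fin_cases i <;> fin_cases j <;>
        simp [haa, hab, hbb, hca, hcb, hcc, dotProduct_comm b a]
    rw [mul_eq_one_comm] at hM
    intro i j
    have := congrFun (congrFun hM i) j
    rw [Matrix.mul_apply, Matrix.one_apply, Fin.sum_univ_three] at this
    exact this
  · have hscale : (fun i => (a i + b i * Complex.I : ℂ)) = (r : ℂ) • v := by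
      ext i
      simp only [a, b, Pi.smul_apply, smul_eq_mul]
      conv_rhs => rw [← Complex.re_add_im (v i)]
      push_cast
      ring
    rw [hscale, aeval_smul_of_isHomogeneous hf, hz, mul_zero]

/-- Modulo `qForm`, every form of positive degree has a linear factor. -/
lemma exists_linear_factor_modulo_qForm {d : ℕ} {f : MvPolynomial (Fin 3) ℝ}
    (hf : f.IsHomogeneous (d + 1)) :
    ∃ l k, l.IsHomogeneous 1 ∧ k.IsHomogeneous d ∧ qForm ∣ f - l * k := by
  obtain ⟨a, b, c, h, haa, hab, hbb, hca, hcb, hz⟩ :=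
    exists_orthonormalColumns_aeval_eq_zero d.succ_ne_zero hf
  obtain ⟨α, β, k, hk, g, hg⟩ := h.exists_reduction d hf
  refine ⟨linForm c, k, linForm_isHomogeneous c, hk, g, ?_⟩
  let ev := aeval (R := ℝ) (fun i => (a i + b i * Complex.I : ℂ))
  have hlin (e : Fin 3 → ℝ) : ev (linForm e) = (e ⬝ᵥ a : ℝ) + (e ⬝ᵥ b : ℝ) * Complex.I := by
    simp only [ev, linForm, map_add, map_mul, aeval_X, aeval_C, Fin.sum_univ_three, dotProduct,
      Complex.coe_algebraMap]
    push_cast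
    ring
  have ha : ev (linForm a) = 1 := by simp [hlin, haa, hab]
  have hb : ev (linForm b) = Complex.I := by simp [hlin, dotProduct_comm b a, hab, hbb]
  have hc : ev (linForm c) = 0 := by simp [hlin, hca, hcb]
  have hq : ev qForm = 0 := by simp [h.qForm_eq, ha, hb, hc]
  have hαβ : (α : ℂ) + β * Complex.I = 0 := by
    have := congrArg ev hg
    simp only [map_sub, map_add, map_mul, map_pow, ha, hb, hc, hq, one_pow, mul_one, one_mul,
      zero_mul, add_zero] at this
    rw [show ev f = 0 from hz] at this
    simp only [ev, aeval_C, Complex.coe_algebraMap] at this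
    linear_combination -this
  have hα : α = 0 := by simpa using congrArg Complex.re hαβ
  have hβ : β = 0 := by simpa using congrArg Complex.im hαβ
  simpa [hα, hβ] using hg

/-- Modulo `qForm`, every form of degree `a + b` factors into forms of degrees `a` and `b`. -/
lemma exists_factorization_modulo_qForm {a b : ℕ} {f : MvPolynomial (Fin 3) ℝ}
    (hf : f.IsHomogeneous (a + b)) :
    ∃ p₁ p₂, p₁.IsHomogeneous a ∧ p₂.IsHomogeneous b ∧ qForm ∣ f - p₁ * p₂ := by
  induction a generalizing f with
  | zero => exact ⟨1, f, isHomogeneous_one _ _, by simpa using hf, by simp⟩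
  | succ a ih =>
    obtain ⟨l, k, hl, hk, g, hg⟩ :=
      exists_linear_factor_modulo_qForm (d := a + b) (by convert hf using 1; omega)
    obtain ⟨p₁, p₂, h₁, h₂, e, he⟩ := ih hk
    refine ⟨l * p₁, p₂, add_comm 1 a ▸ hl.mul h₁, h₂, g + l * e, ?_⟩
    linear_combination hg + l * he

/-- Every harmonic homogeneous polynomial of even degree `2n` on `ℝ³` is a difference of
harmonic squares: `h = h₁ ∗ h₁ − h₂ ∗ h₂` with `h₁, h₂` harmonic of degree `n`. -/
theorem harmonic_difference_of_squares (star : MvPolynomial (Fin 3) ℝ →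
      MvPolynomial (Fin 3) ℝ → MvPolynomial (Fin 3) ℝ) (hstar : IsHarmonicProduct star)
    (n : ℕ) (h : MvPolynomial (Fin 3) ℝ)
    (hharm : Harmonic h) (hhom : h.IsHomogeneous (2 * n)) :
    ∃ h₁ h₂ : MvPolynomial (Fin 3) ℝ,
      Harmonic h₁ ∧ h₁.IsHomogeneous n ∧ Harmonic h₂ ∧ h₂.IsHomogeneous n ∧
        h = star h₁ h₁ - star h₂ h₂ := by
  obtain ⟨f₁, f₂, hf₁, hf₂, hf⟩ := exists_factorization_modulo_qForm (two_mul n ▸ hhom)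
  obtain ⟨p₁, hp₁, hd₁, hq₁⟩ := exists_harmonic_sub hf₁
  obtain ⟨p₂, hp₂, hd₂, hq₂⟩ := exists_harmonic_sub hf₂
  have harm (c : ℝ) : Harmonic ((2⁻¹ : ℝ) • (p₁ + c • p₂)) := by
    rw [Harmonic, lap_smul, lap_add, lap_smul, hp₁, hp₂, smul_zero, add_zero, smul_zero]
  have hom (c : ℝ) : ((2⁻¹ : ℝ) • (p₁ + c • p₂)).IsHomogeneous n :=
    (homogeneousSubmodule (Fin 3) ℝ n).smul_mem _
      (Submodule.add_mem _ hd₁ ((homogeneousSubmodule (Fin 3) ℝ n).smul_mem _ hd₂))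
  refine ⟨_, _, harm 1, hom 1, harm (-1), hom (-1), ?_⟩
  obtain ⟨hs₁, g₁, hg₁⟩ := hstar _ _ (harm 1) (harm 1)
  obtain ⟨hs₂, g₂, hg₂⟩ := hstar _ _ (harm (-1)) (harm (-1))
  rw [← sub_eq_zero]
  apply Harmonic.eq_zero_of_dvd
  · rw [Harmonic, lap_sub, lap_sub, hharm, hs₁, hs₂, sub_zero, sub_zero]
  · obtain ⟨a, ha⟩ := hf
    obtain ⟨b₁, hb₁⟩ := hq₁
    obtain ⟨b₂, hb₂⟩ := hq₂
    refine ⟨a + b₁ * f₂ + p₁ * b₂ + g₁ - g₂, ?_⟩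
    have h4 : (C (2⁻¹ : ℝ) : MvPolynomial (Fin 3) ℝ) ^ 2 * 4 = 1 := by
      rw [show (4 : MvPolynomial (Fin 3) ℝ) = C 4 from (map_ofNat C 4).symm, ← C_pow, ← C_mul]
      norm_num
    simp only [smul_eq_C_mul, C_neg, C_1] at hg₁ hg₂ ⊢
    linear_combination ha + f₂ * hb₁ + p₁ * hb₂ + hg₁ - hg₂ - p₁ * p₂ * h4
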